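/- Let n₁, n₂ be integers and set n = n₁ − n₂. Then there exist a ∈ {0,…,ℓ^f−2}, b ∈ {1,…,ℓ}^f and two distinct subsets B₁ ≠ B₂ of {0,…,f−1} with (a,b,B₁) ∈ T(n₁,n₂) and (a,b,B₂) ∈ T(n₁,n₂) if and only if there exist integers r ≥ 0 and m with (ℓ−1)·|m| ≤ max{0, ℓ^{f−1} − ℓ} such that ℓ^r · n ≡ m (mod ℓ^f − 1). -/

import Mathlib

namespace Stmt18

/-- The set `T(n₁,n₂)` of triples `(a,b,B)` with `a ∈ {0,…,ℓ^f−2}`,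
`b ∈ {1,…,ℓ}^f`, `B ⊆ {0,…,f−1}`, with
`n₁ ≡ a + ∑_{i∈B} b_i ℓ^i` and `n₂ ≡ a + ∑_{i∉B} b_i ℓ^i (mod ℓ^f−1)`. -/
def Tset2 (ℓ f : ℕ) (n₁ n₂ : ℤ) : Set (ℤ × (Fin f → ℤ) × Finset (Fin f)) :=
  {x | (0 ≤ x.1 ∧ x.1 ≤ (ℓ : ℤ) ^ f - 2) ∧
    (∀ i, 1 ≤ x.2.1 i ∧ x.2.1 i ≤ (ℓ : ℤ)) ∧
    Int.ModEq ((ℓ : ℤ) ^ f - 1) n₁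
      (x.1 + ∑ i ∈ x.2.2, x.2.1 i * (ℓ : ℤ) ^ (i : ℕ)) ∧
    Int.ModEq ((ℓ : ℤ) ^ f - 1) n₂
      (x.1 + ∑ i ∈ x.2.2ᶜ, x.2.1 i * (ℓ : ℤ) ^ (i : ℕ))}

/-- combined data -/
def GG (l : ℤ) (k : ℕ) (n : ℤ) (u v : Fin (k+1) → ℤ) : Prop :=
  (∀ i, |u i| ≤ l ∧ |v i| ≤ l ∧ (u i = 0 ↔ v i ≠ 0)) ∧
  (l^(k+1) - 1 ∣ ∑ i, u i * l^(i:ℕ)) ∧ (l^(k+1) - 1 ∣ n - ∑ i, v i * l^(i:ℕ))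

def rot {k : ℕ} (u : Fin (k+1) → ℤ) : Fin (k+1) → ℤ :=
  Fin.cons (u (Fin.last k)) (fun i => u i.castSucc)

lemma rot_sum (l : ℤ) {k : ℕ} (u : Fin (k+1) → ℤ) :
    ∑ i, rot u i * l^(i:ℕ) = l * (∑ i, u i * l^(i:ℕ)) - u (Fin.last k) * (l^(k+1) - 1) := by
  rw [Fin.sum_univ_succ, Fin.sum_univ_castSucc (f := fun i => u i * l^(i:ℕ))]
  simp only [rot, Fin.cons_zero, Fin.cons_succ, Fin.val_zero, Fin.val_succ, Fin.val_castSucc,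
    Fin.val_last, mul_add, Finset.mul_sum]
  have : ∀ i : Fin k, u i.castSucc * l^((i:ℕ)+1) = l * (u i.castSucc * l^(i:ℕ)) := by
    intro i; ring
  simp only [this]
  ring

lemma GG.rot {l : ℤ} {k : ℕ} {n : ℤ} {u v : Fin (k+1) → ℤ} (h : GG l k n u v) :
    GG l k (l * n) (rot u) (rot v) := by
  obtain ⟨h1, h2, h3⟩ := h
  refine ⟨?_, ?_, ?_⟩
  · intro i
    refine Fin.cases ?_ (fun j => ?_) i
    · simpa [Stmt18.rot] using h1 (Fin.last k)
    · simpa [Stmt18.rot] using h1 j.castSucc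
  · rw [rot_sum]
    exact dvd_sub (h2.mul_left _) (dvd_mul_left _ _)
  · rw [rot_sum]
    have : l * n - (l * (∑ i, v i * l^(i:ℕ)) - v (Fin.last k) * (l^(k+1) - 1))
      = l * (n - ∑ i, v i * l^(i:ℕ)) + v (Fin.last k) * (l^(k+1) - 1) := by ring
    rw [this]
    exact dvd_add (h3.mul_left _) (dvd_mul_left _ _)

lemma rot_ne {k : ℕ} (u : Fin (k+1) → ℤ) (P : ℤ → Prop) (h : ∃ i, P (u i)) :
    ∃ i, P (rot u i) := by
  obtain ⟨i, hi⟩ := h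
  refine Fin.lastCases (motive := fun i => P (u i) → _) ?_ (fun j => ?_) i hi
  · intro h; exact ⟨0, by simpa [rot] using h⟩
  · intro h; exact ⟨j.succ, by simpa [rot] using h⟩

lemma claimB {l : ℤ} {k : ℕ} (d : ℕ) : ∀ {n : ℤ} {u v : Fin (k+1) → ℤ} (_ : GG l k n u v)
    (p : Fin (k+1)) (_ : (p:ℕ) + d = k) (_ : u p ≠ 0) (_ : ∃ i, u i = 0),
    ∃ r u' v', GG l k (l^r * n) u' v' ∧ u' 0 ≠ 0 ∧ ∃ i, u' i = 0 := by
  induction d with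
  | zero =>
    intro n u v h p hp hu hz
    have : p = Fin.last k := by ext; simpa using hp
    subst this
    exact ⟨1, _, _, by simpa using h.rot, by simpa [rot] using hu, rot_ne u (· = 0) hz⟩
  | succ d ih =>
    intro n u v h p hp hu hz
    have hlt : (p:ℕ) < k := by omega
    have hq := ih h.rot (Fin.succ ⟨p, hlt⟩) (by simp; omega)
      (by rw [rot, Fin.cons_succ]; exact hu) (rot_ne u (· = 0) hz)
    obtain ⟨r, u', v', h1, h2⟩ := hq
    exact ⟨r+1, u', v', by rw [pow_succ, mul_assoc]; exact h1, h2⟩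

lemma claimA {l : ℤ} {k : ℕ} (d : ℕ) : ∀ {n : ℤ} {u v : Fin (k+1) → ℤ} (_ : GG l k n u v)
    (p : Fin (k+1)) (_ : (p:ℕ) + d = k) (_ : u p = 0) (_ : u 0 ≠ 0),
    ∃ r u' v', GG l k (l^r * n) u' v' ∧ u' 0 ≠ 0 ∧ u' (Fin.last k) = 0 := by
  induction d with
  | zero =>
    intro n u v h p hp hu hz
    have : p = Fin.last k := by ext; simpa using hp
    subst this
    exact ⟨0, u, v, by simpa using h, hz, hu⟩
  | succ d ih =>
    intro n u v h p hp hu hz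
    by_cases hL : u (Fin.last k) = 0
    · exact ⟨0, u, v, by simpa using h, hz, hL⟩
    have hlt : (p:ℕ) < k := by omega
    have hq := ih h.rot (Fin.succ ⟨p, hlt⟩) (by simp; omega)
      (by rw [rot, Fin.cons_succ]; exact hu) (by simpa [rot] using hL)
    obtain ⟨r, u', v', h1, h2⟩ := hq
    exact ⟨r+1, u', v', by rw [pow_succ, mul_assoc]; exact h1, h2⟩

lemma sum_bound {l : ℤ} (hl : 2 ≤ l) {k : ℕ} (w : Fin k → ℤ) (hw : ∀ i, |w i| ≤ l) :
    (l - 1) * |∑ i, w i * l^(i:ℕ)| ≤ l^(k+1) - l := by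
  have h1 : |∑ i, w i * l^(i:ℕ)| ≤ ∑ i : Fin k, l * l^(i:ℕ) := by
    refine (Finset.abs_sum_le_sum_abs _ _).trans (Finset.sum_le_sum fun i _ => ?_)
    have hp : (0:ℤ) ≤ l^(i:ℕ) := by positivity
    rw [abs_mul, abs_of_nonneg hp]
    exact mul_le_mul_of_nonneg_right (hw i) hp
  have h2 : (l - 1) * ∑ i : Fin k, l * l^(i:ℕ) = l^(k+1) - l := by
    rw [← Finset.mul_sum, Fin.sum_univ_eq_sum_range (fun i => l^i)]
    have := geom_sum_mul l k
    linear_combination l * this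
  rw [← h2]
  exact mul_le_mul_of_nonneg_left h1 (by omega)

lemma forward {l : ℤ} (hl : 2 ≤ l) {k : ℕ} {n : ℤ} {u v : Fin (k+1) → ℤ} (h : GG l k n u v)
    (h0 : u 0 ≠ 0) (hL : u (Fin.last k) = 0) :
    ∃ (r : ℕ) (m : ℤ), (l - 1) * |m| ≤ l^k - l ∧ l^(k+1) - 1 ∣ l^r * n - m := by
  obtain ⟨h1, h2, h3⟩ := h
  have hS : ∑ i, u i * l^(i:ℕ) = 0 := by
    apply Int.eq_zero_of_abs_lt_dvd h2
    rw [Fin.sum_univ_castSucc, hL]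
    have := sum_bound hl (fun i : Fin k => u i.castSucc) (fun i => (h1 _).1)
    simp only [Fin.val_castSucc, zero_mul, add_zero]
    nlinarith [abs_nonneg (∑ i : Fin k, u i.castSucc * l^(i:ℕ))]
  obtain _ | k := k
  · exact absurd hL h0
  rw [Fin.sum_univ_succ, Fin.sum_univ_succ] at hS h3
  set A := ∑ i : Fin k, u i.succ.succ * l^(i:ℕ) with hA
  set m := ∑ i : Fin k, v i.succ.succ * l^(i:ℕ) with hm
  have e : ∀ w : Fin (k+2) → ℤ, ∑ i : Fin k, w i.succ.succ * l^((i.succ.succ : Fin (k+2)) : ℕ)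
      = l^2 * ∑ i : Fin k, w i.succ.succ * l^(i:ℕ) := by
    intro w
    rw [Finset.mul_sum]
    refine Finset.sum_congr rfl fun i _ => ?_
    simp only [Fin.val_succ]; ring
  rw [e] at hS h3
  simp only [Fin.val_zero, Fin.val_succ, pow_zero, mul_one, zero_add, pow_one] at hS h3
  have hu1 : u (Fin.succ 0) ≠ 0 := by
    intro hz
    rw [hz] at hS
    apply h0
    apply Int.eq_zero_of_abs_lt_dvd (m := l^2) ⟨-A, by rw [hA]; linarith⟩
    have := (h1 0).1
    nlinarith
  have hv0 : v 0 = 0 := by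
    by_contra hc; exact h0 ((h1 0).2.2.2 hc)
  have hv1 : v (Fin.succ 0) = 0 := by
    by_contra hc; exact hu1 ((h1 _).2.2.2 hc)
  refine ⟨k, m, sum_bound hl _ (fun i => (h1 _).2.1), ?_⟩
  rw [hv0, hv1] at h3
  have : l^k * n - m = l^k * (n - (0 + (0 * l + l^2 * m))) + (l^(k+1+1) - 1) * m := by ring
  rw [this]
  exact dvd_add (h3.mul_left _) (dvd_mul_right _ _)

lemma repr_pos {l : ℤ} (hl : 2 ≤ l) (k : ℕ) : ∀ m : ℤ, 0 < m →
    (l - 1) * m ≤ l^(k+2) - l → ∃ y : Fin (k+1) → ℤ, (∀ i, |y i| ≤ l ∧ y i ≠ 0) ∧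
      ∑ i, y i * l^(i:ℕ) = m := by
  induction k with
  | zero =>
    intro m hm hb
    have : m ≤ l := by
      have : (l - 1) * m ≤ (l - 1) * l := by linarith [show l^(0+2) - l = (l-1)*l by ring]
      exact le_of_mul_le_mul_left this (by omega)
    exact ⟨fun _ => m, fun _ => ⟨by rw [abs_of_pos hm]; exact this, hm.ne'⟩, by simp⟩
  | succ k ih =>
    intro m hm hb
    suffices H : ∃ m' y0 : ℤ, 0 < m' ∧ (l-1) * m' ≤ l^(k+2) - l ∧ |y0| ≤ l ∧ y0 ≠ 0 ∧
        m = y0 + l * m' by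
      obtain ⟨m', y0, h1, h2, h3, h4, h5⟩ := H
      obtain ⟨y, hy, hs⟩ := ih m' h1 h2
      refine ⟨Fin.cons y0 y, ?_, ?_⟩
      · intro i
        refine Fin.cases ?_ (fun j => ?_) i
        · simpa using ⟨h3, h4⟩
        · simpa using hy j
      · rw [Fin.sum_univ_succ]
        simp only [Fin.cons_zero, Fin.cons_succ, Fin.val_zero, Fin.val_succ, pow_zero, mul_one]
        rw [h5, ← hs, Finset.mul_sum]
        congr 1
        exact Finset.sum_congr rfl fun i _ => by ring
    have hM : l^2 ≤ l^(k+2) := pow_le_pow_right₀ (by omega) (by omega)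
    have hpow : l^(k+1+2) = l * l^(k+2) := by ring
    rw [hpow] at hb
    set P := l^(k+2) with hP
    set t := m / l with ht
    set s := m % l with hs
    have hms : m = s + l * t := (Int.emod_add_mul_ediv m l).symm
    have hs0 : 0 ≤ s := Int.emod_nonneg _ (by omega)
    have hs1 : s < l := Int.emod_lt_of_pos _ (by omega)
    have ht0 : 0 ≤ t := Int.ediv_nonneg hm.le (by omega)
    have hb1 : (l - 1) * t ≤ P - 1 := by
      rw [hms] at hb
      have : l * ((l-1) * t) ≤ l * (P - 1) := by nlinarith
      exact le_of_mul_le_mul_left this (by omega)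
    rcases ht0.eq_or_lt with hz | hz
    · refine ⟨1, s - l, one_pos, by nlinarith, ?_, by omega, by rw [hms, ← hz]; ring⟩
      rw [abs_le]; constructor <;> omega
    rcases hs0.eq_or_lt with hy | hy
    · by_cases h1 : t = 1
      · refine ⟨2, -l, two_pos, by nlinarith, ?_, by omega, by rw [hms, ← hy, h1]; ring⟩
        rw [abs_neg, abs_of_nonneg (by omega)]
      · refine ⟨t - 1, l, by omega, by linarith, ?_, by omega, by rw [hms, ← hy]; ring⟩
        rw [abs_of_nonneg (by omega)]
    · refine ⟨t, s, hz, ?_, by rw [abs_of_pos hy]; omega, by omega, hms⟩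
      -- strictness together with divisibility
      have hd : l - 1 ∣ P - 1 := by
        simpa using sub_one_dvd_pow_sub_one l (k+2)
      obtain ⟨c, hc⟩ := hd
      have hlt : (l-1) * t < (l-1) * c := by
        rw [← hc]
        rw [hms] at hb
        have : l * ((l-1) * t) < l * (P - 1) := by nlinarith
        exact lt_of_mul_lt_mul_left this (by omega)
      have : t < c := lt_of_mul_lt_mul_left hlt (by omega)
      nlinarith

lemma GG.rots {l : ℤ} {k : ℕ} {n : ℤ} (r : ℕ) : ∀ {u v : Fin (k+1) → ℤ}, GG l k n u v →
    (∃ i, u i ≠ 0) → ∃ u' v', GG l k (l^r * n) u' v' ∧ ∃ i, u' i ≠ 0 := by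
  induction r with
  | zero => intro u v h hi; exact ⟨u, v, by simpa using h, hi⟩
  | succ r ih =>
    intro u v h hi
    obtain ⟨u', v', h', hi'⟩ := ih h hi
    refine ⟨Stmt18.rot u', Stmt18.rot v', ?_, rot_ne u' (· ≠ 0) hi'⟩
    have := h'.rot
    rwa [← mul_assoc, ← pow_succ'] at this

lemma GG.congr {l : ℤ} {k : ℕ} {n n' : ℤ} {u v : Fin (k+1) → ℤ} (h : GG l k n u v)
    (hn : l^(k+1) - 1 ∣ n' - n) : GG l k n' u v :=
  ⟨h.1, h.2.1, by have := dvd_add hn h.2.2; rwa [sub_add_sub_cancel] at this⟩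

lemma GG.neg {l : ℤ} {k : ℕ} {n : ℤ} {u v : Fin (k+1) → ℤ} (h : GG l k n u v) :
    GG l k (-n) (-u) (-v) := by
  obtain ⟨h1, h2, h3⟩ := h
  refine ⟨fun i => by simpa using h1 i, ?_, ?_⟩
  · simpa using h2
  · have := h3.neg_right
    simpa [neg_sub, add_comm, sub_eq_add_neg] using this

lemma backward_pos {l : ℤ} (hl : 2 ≤ l) {k : ℕ} {m : ℤ} (hm : 0 < m)
    (hb : (l - 1) * m ≤ max 0 (l^k - l)) :
    ∃ u v, GG l k (l^2 * m) u v ∧ ∃ i, u i ≠ 0 := by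
  have hb' : (l - 1) * m ≤ l^k - l := by
    rcases le_max_iff.1 hb with h | h
    · nlinarith
    · exact h
  obtain _ | _ | k := k
  · simp at hb'; nlinarith
  · simp at hb'; nlinarith
  obtain ⟨y, hy, hs⟩ := repr_pos hl k m hm hb'
  refine ⟨Fin.cons l (Fin.cons (-1) (fun _ => 0)), Fin.cons 0 (Fin.cons 0 y), ⟨?_, ?_, ?_⟩,
    0, by simp; omega⟩
  · intro i
    refine Fin.cases ?_ (fun j => Fin.cases ?_ (fun j => ?_) j) i
    · simp [abs_of_nonneg (show 0 ≤ l by omega)]; omega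
    · simp; omega
    · simpa using ⟨by omega, hy j⟩
  · rw [Fin.sum_univ_succ, Fin.sum_univ_succ]
    simp
  · rw [Fin.sum_univ_succ, Fin.sum_univ_succ]
    simp only [Fin.cons_zero, Fin.cons_succ, Fin.val_succ, zero_mul, zero_add]
    have : ∑ i : Fin (k+1), y i * l^((i:ℕ)+1+1) = l^2 * m := by
      rw [← hs, Finset.mul_sum]
      exact Finset.sum_congr rfl fun i _ => by ring
    rw [this]; simp

lemma backward_zero {l : ℤ} (hl : 2 ≤ l) {k : ℕ} :
    ∃ u v, GG l k 0 u v ∧ ∃ i, u i ≠ 0 := by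
  refine ⟨fun _ => l - 1, fun _ => 0, ⟨?_, ?_, by simp⟩, 0, by simp; omega⟩
  · intro i
    simp only [abs_of_nonneg (show 0 ≤ l - 1 by omega)]
    simp; omega
  · rw [← Finset.mul_sum, Fin.sum_univ_eq_sum_range (fun i => l^i), mul_comm, geom_sum_mul]

lemma GG_iff {l : ℤ} (hl : 2 ≤ l) {k : ℕ} (n : ℤ) :
    (∃ u v, GG l k n u v ∧ ∃ i, u i ≠ 0) ↔
    ∃ (r : ℕ) (m : ℤ), (l - 1) * |m| ≤ max 0 (l^k - l) ∧ l^(k+1) - 1 ∣ l^r * n - m := by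
  constructor
  · rintro ⟨u, v, h, p, hp⟩
    by_cases hz : ∃ i, u i = 0
    · obtain ⟨r, u', v', h', h0, q, hq⟩ := claimB (k - p) h p (by omega) hp hz
      obtain ⟨r2, u2, v2, h2, h02, hL⟩ := claimA (k - q) h' q (by omega) hq h0
      obtain ⟨r3, m, hm, hd⟩ := forward hl h2 h02 hL
      refine ⟨r3 + r2 + r, m, hm.trans (le_max_right _ _), ?_⟩
      have e : l^(r3+r2+r) * n = l^r3 * (l^r2 * (l^r * n)) := by ring
      rwa [e]
    · push Not at hz
      have hv : ∀ i, v i = 0 := by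
        intro i; by_contra hc; exact hz i ((h.1 i).2.2.2 hc)
      have := h.2.2
      simp only [hv, zero_mul, Finset.sum_const_zero, sub_zero] at this
      exact ⟨0, 0, by simp, by simpa using this⟩
  · rintro ⟨r, m, hm, hd⟩
    have key : ∃ u v, GG l k (l^2 * m) u v ∧ ∃ i, u i ≠ 0 := by
      rcases lt_trichotomy m 0 with h | h | h
      · rw [abs_of_neg h] at hm
        obtain ⟨u, v, h1, i, hi⟩ := backward_pos hl (m := -m) (by omega) hm
        exact ⟨-u, -v, by simpa using h1.neg, i, by simpa using hi⟩
      · subst h; simpa using backward_zero hl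
      · rw [abs_of_pos h] at hm
        exact backward_pos hl h hm
    obtain ⟨u, v, h, hi⟩ := key
    obtain ⟨u', v', h', hi'⟩ := h.rots ((r+2) * k) hi
    refine ⟨u', v', h'.congr ?_, hi'⟩
    have h1 : l^(k+1) - 1 ∣ l^((k+1)*(r+2)) - 1 := by
      rw [pow_mul]; exact sub_one_dvd_pow_sub_one _ _
    have e : n - l^((r+2)*k) * (l^2 * m) =
        l^((r+2)*k) * l^2 * (l^r * n - m) - (l^((k+1)*(r+2)) - 1) * n := by ring
    rw [e]
    exact dvd_sub (hd.mul_left _) (h1.mul_right _)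

lemma dv {N x y : ℤ} (h : N ∣ x) (e : y = x) : N ∣ y := e ▸ h

lemma sum_ind {k : ℕ} (B : Finset (Fin k)) (g : Fin k → ℤ) :
    ∑ i ∈ B, g i = ∑ i, if i ∈ B then g i else 0 := by
  rw [Finset.sum_ite_mem, Finset.univ_inter]

lemma LHS_iff (ℓ k : ℕ) (hl : 2 ≤ ℓ) (n₁ n₂ : ℤ) :
    (∃ (a : ℤ) (b : Fin (k+1) → ℤ) (B₁ B₂ : Finset (Fin (k+1))), B₁ ≠ B₂ ∧
      (a, b, B₁) ∈ Tset2 ℓ (k+1) n₁ n₂ ∧ (a, b, B₂) ∈ Tset2 ℓ (k+1) n₁ n₂) ↔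
    ∃ u v, GG (ℓ:ℤ) k (n₁ - n₂) u v ∧ ∃ i, u i ≠ 0 := by
  set l : ℤ := (ℓ:ℤ) with hldef
  have hl' : 2 ≤ l := by omega
  simp only [Tset2, Set.mem_ofPred_eq]
  constructor
  · rintro ⟨a, b, B₁, B₂, hne, ⟨-, hb, h11, h12⟩, ⟨-, -, h21, h22⟩⟩
    have h11 := h11.symm.dvd
    have h12 := h12.symm.dvd
    have h21 := h21.symm.dvd
    refine ⟨fun i => (if i ∈ B₁ then b i else 0) - (if i ∈ B₂ then b i else 0),
      fun i => (if i ∈ B₂ then b i else 0) - (if i ∈ B₁ᶜ then b i else 0), ⟨?_, ?_, ?_⟩, ?_⟩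
    · intro i
      have := hb i
      have h0 : |b i| ≤ l := by rw [abs_of_nonneg (by omega)]; exact this.2
      by_cases h1 : i ∈ B₁ <;> by_cases h2 : i ∈ B₂ <;> simp [h1, h2, h0] <;> omega
    · have := dvd_sub h21 h11
      rw [sum_ind B₂, sum_ind B₁] at this
      simp only [sub_mul, ite_mul, zero_mul, Finset.sum_sub_distrib]
      refine dv (this) ?_; ring
    · have := dvd_sub h21 h12
      rw [sum_ind B₂, sum_ind B₁ᶜ] at this
      simp only [sub_mul, ite_mul, zero_mul, Finset.sum_sub_distrib]
      refine dv (this) ?_; ring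
    · by_contra hc
      push Not at hc
      apply hne
      ext i
      have := hc i
      have := hb i
      by_cases h1 : i ∈ B₁ <;> by_cases h2 : i ∈ B₂ <;> simp_all
  · rintro ⟨u, v, ⟨h1, h2, h3⟩, p, hp⟩
    have hN : 0 < l^(k+1) - 1 := by
      have : l^1 ≤ l^(k+1) := pow_le_pow_right₀ (by omega) (by omega)
      rw [pow_one] at this; omega
    let b : Fin (k+1) → ℤ := fun i => |u i| + |v i|
    let B₁ : Finset (Fin (k+1)) := {i | 0 < u i + v i}
    let B₂ : Finset (Fin (k+1)) := {i | 0 < v i - u i}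
    have hb : ∀ i, 1 ≤ b i ∧ b i ≤ l := by
      intro i
      obtain ⟨ha, hb, hc⟩ := h1 i
      show 1 ≤ |u i| + |v i| ∧ |u i| + |v i| ≤ l
      by_cases hu : u i = 0
      · have := abs_pos.2 (hc.1 hu)
        simp only [hu, abs_zero]; omega
      · have hv : v i = 0 := by by_contra h; exact hu (hc.2 h)
        have := abs_pos.2 hu
        simp only [hv, abs_zero]; omega
    have hxor : ∀ i, (u i = 0 ∧ v i ≠ 0) ∨ (u i ≠ 0 ∧ v i = 0) := by
      intro i
      have := (h1 i).2.2
      tauto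
    -- pointwise identities
    have e12 : ∑ i ∈ B₁, b i * l^(i:ℕ) - ∑ i ∈ B₂, b i * l^(i:ℕ) = ∑ i, u i * l^(i:ℕ) := by
      rw [sum_ind B₁, sum_ind B₂, ← Finset.sum_sub_distrib]
      refine Finset.sum_congr rfl fun i _ => ?_
      have : u i = (if i ∈ B₁ then b i else 0) - (if i ∈ B₂ then b i else 0) := by
        simp only [B₁, B₂, b, Finset.mem_filter, Finset.mem_univ, true_and]
        have := hxor i
        rcases abs_cases (u i) with h | h <;> rcases abs_cases (v i) with h' | h' <;>
          split_ifs <;> omega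
      rw [this]; split_ifs <;> ring
    have e1 : ∑ i ∈ B₁, b i * l^(i:ℕ) - ∑ i ∈ B₁ᶜ, b i * l^(i:ℕ)
        = ∑ i, u i * l^(i:ℕ) + ∑ i, v i * l^(i:ℕ) := by
      rw [sum_ind B₁, sum_ind B₁ᶜ, ← Finset.sum_sub_distrib, ← Finset.sum_add_distrib]
      refine Finset.sum_congr rfl fun i _ => ?_
      have : u i + v i = (if i ∈ B₁ then b i else 0) - (if i ∈ B₁ᶜ then b i else 0) := by
        simp only [B₁, b, Finset.mem_compl, Finset.mem_filter, Finset.mem_univ, true_and]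
        have := hxor i
        rcases abs_cases (u i) with h | h <;> rcases abs_cases (v i) with h' | h' <;>
          split_ifs <;> omega
      rw [← add_mul, this]; split_ifs <;> ring
    have c1 := Finset.sum_add_sum_compl B₁ (fun i => b i * l^(i:ℕ))
    have c2 := Finset.sum_add_sum_compl B₂ (fun i => b i * l^(i:ℕ))
    set S1 := ∑ i ∈ B₁, b i * l^(i:ℕ)
    set S2 := ∑ i ∈ B₂, b i * l^(i:ℕ)
    set S1c := ∑ i ∈ B₁ᶜ, b i * l^(i:ℕ)
    set S2c := ∑ i ∈ B₂ᶜ, b i * l^(i:ℕ)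
    set N := l^(k+1) - 1
    set U := ∑ i, u i * l^(i:ℕ)
    set V := ∑ i, v i * l^(i:ℕ)
    have ha : N ∣ n₁ - S1 - (n₁ - S1) % N := Int.dvd_self_sub_emod
    set a := (n₁ - S1) % N with hadef
    have ha0 : 0 ≤ a := Int.emod_nonneg _ hN.ne'
    have ha1 : a < N := Int.emod_lt_of_pos _ hN
    have har : 0 ≤ a ∧ a ≤ l^(k+1) - 2 := ⟨ha0, by omega⟩
    have d1 : N ∣ n₁ - (a + S1) := by refine dv (ha) ?_; ring
    have d2 : N ∣ n₂ - (a + S1c) := by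
      refine dv (dvd_add (dvd_sub d1 h3) h2) ?_; linarith
    refine ⟨a, b, B₁, B₂, ?_, ⟨har, hb, ?_, ?_⟩, ⟨har, hb, ?_, ?_⟩⟩
    · intro h
      have hm : p ∈ B₁ ↔ p ∈ B₂ := by rw [h]
      simp only [B₁, B₂, Finset.mem_filter, Finset.mem_univ, true_and] at hm
      have := hxor p
      omega
    · exact (Int.modEq_iff_dvd.2 d1).symm
    · exact (Int.modEq_iff_dvd.2 d2).symm
    · refine (Int.modEq_iff_dvd.2 ?_).symm
      refine dv (dvd_add d1 h2) ?_; linarith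
    · refine (Int.modEq_iff_dvd.2 ?_).symm
      refine dv (dvd_sub d2 h2) ?_; linarith

/-- There exist `a`, `b` and distinct subsets `B₁ ≠ B₂` with
`(a,b,B₁), (a,b,B₂) ∈ T(n₁,n₂)` iff there exist integers `r ≥ 0` and `m` with
`(ℓ−1)|m| ≤ max{0, ℓ^{f−1} − ℓ}` such that `ℓ^r (n₁−n₂) ≡ m (mod ℓ^f − 1)`. -/
theorem stmt18 (ℓ f : ℕ) (hℓ : ℓ.Prime) (hf : 0 < f) (h2 : 2 < ℓ ^ f)
    (n₁ n₂ : ℤ) :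
    (∃ (a : ℤ) (b : Fin f → ℤ) (B₁ B₂ : Finset (Fin f)), B₁ ≠ B₂ ∧
      (a, b, B₁) ∈ Tset2 ℓ f n₁ n₂ ∧ (a, b, B₂) ∈ Tset2 ℓ f n₁ n₂) ↔
    (∃ (r : ℕ) (m : ℤ),
      ((ℓ : ℤ) - 1) * |m| ≤ max 0 ((ℓ : ℤ) ^ (f - 1) - (ℓ : ℤ)) ∧
      Int.ModEq ((ℓ : ℤ) ^ f - 1) ((ℓ : ℤ) ^ r * (n₁ - n₂)) m) := by
  obtain ⟨k, rfl⟩ : ∃ k, f = k + 1 := ⟨f - 1, by omega⟩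
  have hl : 2 ≤ ℓ := hℓ.two_le
  rw [LHS_iff ℓ k hl, GG_iff (by exact_mod_cast hl)]
  simp only [Nat.add_sub_cancel]
  refine exists_congr fun r => exists_congr fun m => and_congr_right fun _ => ?_
  rw [Int.modEq_comm, Int.modEq_iff_dvd]

end Stmt18
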